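/- Let ρ_AB be a density operator on H_A ⊗ H_B and let α, β, γ ≠ 1 satisfy α/(α−1) = β/(β−1) + γ/(γ−1). If α ∈ (0,1), β ∈ [1/2,1) and γ ∈ (1,∞), then I↑_γ(A;B)_ρ ≥ H_β(B)_ρ − H↓_α(B|A)_ρ and I↓_γ(A:B)_ρ ≥ H_β(B)_ρ − H↑_α(B|A)_ρ. If γ ∈ [1/2,1), β ∈ (1,2) and α ∈ (1,∞), then I↑_γ(A;B)_ρ ≤ H_β(B)_ρ − H↓_α(B|A)_ρ and I↓_γ(A:B)_ρ ≤ H_β(B)_ρ − H↑_α(B|A)_ρ. -/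

import Mathlib

open scoped Kronecker ComplexOrder Classical
open Matrix

noncomputable section

/-- Real power taken on the support: `0 ^ r = 0` for every `r`. -/
def supPow (x r : ℝ) : ℝ := if x = 0 then 0 else x ^ r

variable {n : Type*} [Fintype n] [DecidableEq n]

/-- Power of a Hermitian matrix, taken on its support (junk value `0` otherwise). -/
def matPow (M : Matrix n n ℂ) (r : ℝ) : Matrix n n ℂ :=
  if hM : M.IsHermitian then
    (hM.eigenvectorUnitary : Matrix n n ℂ) *
      (Matrix.diagonal fun i => (supPow (hM.eigenvalues i) r : ℂ)) *
      (star (hM.eigenvectorUnitary : Matrix n n ℂ))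
  else 0

/-- A density operator: positive semidefinite with unit trace. -/
def IsDensity (ρ : Matrix n n ℂ) : Prop := ρ.PosSemidef ∧ ρ.trace = 1

/-- `σ` dominates `ρ`: the kernel of `σ` is contained in the kernel of `ρ`
(equivalently, `supp ρ ⊆ supp σ` for positive semidefinite matrices). -/
def Dominates (σ ρ : Matrix n n ℂ) : Prop := ∀ v, σ.mulVec v = 0 → ρ.mulVec v = 0

/-- The sandwiched Rényi divergence of order `α` (base-2 logarithm), with value `⊤`
when `ρ ⟂ σ`, or when `α > 1` and `supp ρ ⊄ supp σ`. -/
def renyiDiv (α : ℝ) (ρ σ : Matrix n n ℂ) : EReal :=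
  if (ρ * σ).trace ≠ 0 ∧ (Dominates σ ρ ∨ α < 1) then
    (((α - 1)⁻¹ * Real.logb 2
      ((matPow (matPow σ ((1 - α) / (2 * α)) * ρ * matPow σ ((1 - α) / (2 * α))) α).trace.re) : ℝ)
      : EReal)
  else ⊤

/-- The Rényi entropy of order `α` (base-2 logarithm). -/
def renyiEntropy (α : ℝ) (ρ : Matrix n n ℂ) : ℝ :=
  (1 - α)⁻¹ * Real.logb 2 ((matPow ρ α).trace.re)

variable {A B : Type*} [Fintype A] [Fintype B] [DecidableEq A] [DecidableEq B]

/-- Marginal on the first factor: `ρ_A = tr_B ρ_AB`. -/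
def margFst (ρ : Matrix (A × B) (A × B) ℂ) : Matrix A A ℂ :=
  Matrix.of fun a a' => ∑ b, ρ (a, b) (a', b)

/-- Marginal on the second factor: `ρ_B = tr_A ρ_AB`. -/
def margSnd (ρ : Matrix (A × B) (A × B) ℂ) : Matrix B B ℂ :=
  Matrix.of fun b b' => ∑ a, ρ (a, b) (a, b')

/-- `H↓_α(B|A)_ρ = −D_α(ρ_AB ‖ ρ_A ⊗ 1_B)`. -/
def condEntDown (α : ℝ) (ρ : Matrix (A × B) (A × B) ℂ) : EReal :=
  - renyiDiv α ρ (margFst ρ ⊗ₖ (1 : Matrix B B ℂ))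

/-- `H↑_α(B|A)_ρ = sup_{σ_A} −D_α(ρ_AB ‖ σ_A ⊗ 1_B)`. -/
def condEntUp (α : ℝ) (ρ : Matrix (A × B) (A × B) ℂ) : EReal :=
  ⨆ σA : {σ : Matrix A A ℂ // IsDensity σ},
    - renyiDiv α ρ ((σA : Matrix A A ℂ) ⊗ₖ (1 : Matrix B B ℂ))

/-- `I↑_γ(A;B)_ρ = inf_{σ_B} D_γ(ρ_AB ‖ ρ_A ⊗ σ_B)`. -/
def mutInfUp (γ : ℝ) (ρ : Matrix (A × B) (A × B) ℂ) : EReal :=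
  ⨅ σB : {σ : Matrix B B ℂ // IsDensity σ},
    renyiDiv γ ρ (margFst ρ ⊗ₖ (σB : Matrix B B ℂ))

/-- `I↓_γ(A:B)_ρ = inf_{σ_A, σ_B} D_γ(ρ_AB ‖ σ_A ⊗ σ_B)`. -/
def mutInfDown (γ : ℝ) (ρ : Matrix (A × B) (A × B) ℂ) : EReal :=
  ⨅ σA : {σ : Matrix A A ℂ // IsDensity σ}, ⨅ σB : {σ : Matrix B B ℂ // IsDensity σ},
    renyiDiv γ ρ ((σA : Matrix A A ℂ) ⊗ₖ (σB : Matrix B B ℂ))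

end

section RenyiDecomposition

lemma supPow_zero_left (r : ℝ) : supPow 0 r = 0 := by simp [supPow]

lemma supPow_nonneg {x : ℝ} (hx : 0 ≤ x) (r : ℝ) : 0 ≤ supPow x r := by
  unfold supPow; split_ifs <;> positivity

lemma supPow_one_right (x : ℝ) : supPow x 1 = x := by
  unfold supPow; split_ifs <;> simp_all

lemma supPow_one_left (r : ℝ) : supPow 1 r = 1 := by simp [supPow]

lemma supPow_eq_rpow (x : ℝ) {r : ℝ} (hr : r ≠ 0) : supPow x r = x ^ r := by
  unfold supPow; split_ifs with h
  · rw [h, Real.zero_rpow hr]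
  · rfl

lemma supPow_mul {x y : ℝ} (hx : 0 ≤ x) (hy : 0 ≤ y) (r : ℝ) :
    supPow (x * y) r = supPow x r * supPow y r := by
  unfold supPow
  by_cases h : x = 0 <;> by_cases h' : y = 0 <;> simp [h, h', Real.mul_rpow hx hy]

lemma supPow_mul_supPow {x : ℝ} (hx : 0 ≤ x) (r t : ℝ) :
    supPow x r * supPow x t = supPow x (r + t) := by
  unfold supPow
  split_ifs with h
  · simp
  · rw [Real.rpow_add (lt_of_le_of_ne hx (Ne.symm h))]

lemma supPow_supPow {x : ℝ} (hx : 0 ≤ x) (r t : ℝ) :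
    supPow (supPow x r) t = supPow x (r * t) := by
  rcases hx.eq_or_lt with rfl | h
  · simp [supPow_zero_left]
  · simp [supPow, h.ne', (Real.rpow_pos_of_pos h r).ne', Real.rpow_mul h.le]

/-- Hölder's inequality in geometric form. -/
lemma sum_rpow_mul_rpow_le {ι : Type*} (s : Finset ι) (x y : ι → ℝ) (hx : ∀ i ∈ s, 0 ≤ x i)
    (hy : ∀ i ∈ s, 0 ≤ y i) {u v : ℝ} (hu : 0 < u) (hv : 0 < v) (huv : u + v = 1) :
    ∑ i ∈ s, x i ^ u * y i ^ v ≤ (∑ i ∈ s, x i) ^ u * (∑ i ∈ s, y i) ^ v := by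
  have hpq : Real.HolderConjugate (1 / u) (1 / v) := by
    rw [Real.holderConjugate_iff]
    refine ⟨by rw [lt_div_iff₀ hu]; linarith, by simpa using huv⟩
  have h := Real.inner_le_Lp_mul_Lq_of_nonneg (s := s) hpq
    (fun i hi => Real.rpow_nonneg (hx i hi) u) (fun i hi => Real.rpow_nonneg (hy i hi) v)
  have e1 : ∑ i ∈ s, (x i ^ u) ^ (1 / u) = ∑ i ∈ s, x i :=
    Finset.sum_congr rfl fun i hi => by
      rw [← Real.rpow_mul (hx i hi), mul_one_div_cancel hu.ne', Real.rpow_one]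
  have e2 : ∑ i ∈ s, (y i ^ v) ^ (1 / v) = ∑ i ∈ s, y i :=
    Finset.sum_congr rfl fun i hi => by
      rw [← Real.rpow_mul (hy i hi), mul_one_div_cancel hv.ne', Real.rpow_one]
  rwa [e1, e2, one_div_one_div, one_div_one_div] at h

variable {n : Type*} [Fintype n] [DecidableEq n]

/-- `M` is diagonalised by the unitary `U` with eigenvalues `d`. -/
structure Diagonalizes (U : Matrix n n ℂ) (d : n → ℝ) (M : Matrix n n ℂ) : Prop where
  star_mul : star U * U = 1
  mul_star : U * star U = 1
  eq : M = U * diagonal (fun i => (d i : ℂ)) * star U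

lemma Matrix.IsHermitian.diagonalizes {M : Matrix n n ℂ} (hM : M.IsHermitian) :
    Diagonalizes (hM.eigenvectorUnitary : Matrix n n ℂ) hM.eigenvalues M where
  star_mul := Unitary.coe_star_mul_self hM.eigenvectorUnitary
  mul_star := Unitary.coe_mul_star_self hM.eigenvectorUnitary
  eq := hM.spectral_theorem

lemma Matrix.PosSemidef.exists_diagonalizes {M : Matrix n n ℂ} (hM : M.PosSemidef) :
    ∃ U d, Diagonalizes U d M ∧ ∀ i, 0 ≤ d i :=
  ⟨_, _, hM.isHermitian.diagonalizes, hM.eigenvalues_nonneg⟩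

lemma Diagonalizes.isHermitian {U M : Matrix n n ℂ} {d : n → ℝ} (h : Diagonalizes U d M) :
    M.IsHermitian := by
  rw [h.eq, IsHermitian, ← star_eq_conjTranspose]
  simp [mul_assoc, star_eq_conjTranspose, diagonal_conjTranspose, Pi.star_def]

lemma Diagonalizes.posSemidef {U M : Matrix n n ℂ} {d : n → ℝ} (h : Diagonalizes U d M)
    (hd : ∀ i, 0 ≤ d i) : M.PosSemidef := by
  rw [h.eq]
  refine PosSemidef.mul_mul_conjTranspose_same (PosSemidef.diagonal ?_) U
  intro i
  simpa using hd i

lemma Diagonalizes.trace_re {U M : Matrix n n ℂ} {d : n → ℝ} (h : Diagonalizes U d M) :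
    M.trace.re = ∑ i, d i := by
  rw [h.eq, trace_mul_comm, ← mul_assoc, h.star_mul, one_mul]
  simp [trace]

lemma Diagonalizes.matPow {U M : Matrix n n ℂ} {d : n → ℝ} (h : Diagonalizes U d M) (r : ℝ) :
    Diagonalizes U (fun i => supPow (d i) r) (matPow M r) where
  star_mul := h.star_mul
  mul_star := h.mul_star
  eq := by
    have hM := h.isHermitian
    have hV := hM.diagonalizes
    rw [_root_.matPow, dif_pos hM]
    set V := (hM.eigenvectorUnitary : Matrix n n ℂ)
    set e := hM.eigenvalues
    have hW : star V * U * diagonal (fun i => (d i : ℂ)) =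
        diagonal (fun i => (e i : ℂ)) * (star V * U) := by
      calc star V * U * diagonal (fun i => (d i : ℂ))
          = star V * (U * diagonal (fun i => (d i : ℂ)) * star U) * U := by
            simp only [mul_assoc, h.star_mul, mul_one]
        _ = star V * (V * diagonal (fun i => (e i : ℂ)) * star V) * U := by rw [← h.eq, ← hV.eq]
        _ = (star V * V) * diagonal (fun i => (e i : ℂ)) * (star V * U) := by
            simp only [mul_assoc]
        _ = _ := by rw [hV.star_mul, one_mul]
    have hW' : star V * U * diagonal (fun i => (supPow (d i) r : ℂ)) =
        diagonal (fun i => (supPow (e i) r : ℂ)) * (star V * U) := by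
      ext i j
      have := congrFun (congrFun hW i) j
      rw [mul_diagonal, diagonal_mul] at this ⊢
      by_cases h0 : (star V * U) i j = 0
      · simp [h0]
      · have hij : (d j : ℂ) = e i := by
          rw [mul_comm] at this; exact mul_right_cancel₀ h0 this
        rw [Complex.ofReal_inj.1 hij, mul_comm]
    calc V * diagonal (fun i => (supPow (e i) r : ℂ)) * star V
        = V * (diagonal (fun i => (supPow (e i) r : ℂ)) * (star V * U)) * star U := by
          simp only [mul_assoc, h.mul_star, mul_one]
      _ = (V * star V) * U * diagonal (fun i => (supPow (d i) r : ℂ)) * star U := by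
          rw [← hW']; simp only [mul_assoc]
      _ = _ := by rw [hV.mul_star, one_mul]

lemma Matrix.PosSemidef.matPow {M : Matrix n n ℂ} (hM : M.PosSemidef) (r : ℝ) :
    (matPow M r).PosSemidef := by
  obtain ⟨U, d, h, hd⟩ := hM.exists_diagonalizes
  exact (h.matPow r).posSemidef fun i => supPow_nonneg (hd i) r

lemma Diagonalizes.ext {U M N : Matrix n n ℂ} {d e : n → ℝ} (hM : Diagonalizes U d M)
    (hN : Diagonalizes U e N) (hde : ∀ i, d i = e i) : M = N := by
  rw [hM.eq, hN.eq, funext hde]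

lemma Diagonalizes.mul {U M N : Matrix n n ℂ} {d e : n → ℝ} (hM : Diagonalizes U d M)
    (hN : Diagonalizes U e N) : Diagonalizes U (fun i => d i * e i) (M * N) where
  star_mul := hM.star_mul
  mul_star := hM.mul_star
  eq := by
    calc M * N = U * diagonal (fun i => (d i : ℂ)) * (star U * U) *
          diagonal (fun i => (e i : ℂ)) * star U := by
            rw [hM.eq, hN.eq]; simp only [mul_assoc]
      _ = _ := by
        rw [hM.star_mul, mul_one, mul_assoc U, diagonal_mul_diagonal]
        simp only [Complex.ofReal_mul]

lemma Diagonalizes.smul {U M : Matrix n n ℂ} {d : n → ℝ} (hM : Diagonalizes U d M) (c : ℝ) :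
    Diagonalizes U (fun i => c * d i) ((c : ℂ) • M) where
  star_mul := hM.star_mul
  mul_star := hM.mul_star
  eq := by
    conv_lhs => rw [hM.eq]
    rw [← smul_mul_assoc, ← mul_smul_comm, ← diagonal_smul]
    congr 3
    ext i
    simp

lemma matPow_one_right {M : Matrix n n ℂ} (hM : M.PosSemidef) : matPow M 1 = M := by
  obtain ⟨U, d, h, hd⟩ := hM.exists_diagonalizes
  exact (h.matPow 1).ext h fun i => supPow_one_right _

lemma matPow_mul_matPow {M : Matrix n n ℂ} (hM : M.PosSemidef) (r t : ℝ) :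
    matPow M r * matPow M t = matPow M (r + t) := by
  obtain ⟨U, d, h, hd⟩ := hM.exists_diagonalizes
  exact ((h.matPow r).mul (h.matPow t)).ext (h.matPow (r + t)) fun i =>
    supPow_mul_supPow (hd i) r t

lemma matPow_matPow {M : Matrix n n ℂ} (hM : M.PosSemidef) (r t : ℝ) :
    matPow (matPow M r) t = matPow M (r * t) := by
  obtain ⟨U, d, h, hd⟩ := hM.exists_diagonalizes
  exact ((h.matPow r).matPow t).ext (h.matPow (r * t)) fun i => supPow_supPow (hd i) r t

lemma matPow_smul {M : Matrix n n ℂ} (hM : M.PosSemidef) {c : ℝ} (hc : 0 ≤ c) (r : ℝ) :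
    matPow ((c : ℂ) • M) r = ((supPow c r : ℝ) : ℂ) • matPow M r := by
  obtain ⟨U, d, h, hd⟩ := hM.exists_diagonalizes
  exact ((h.smul c).matPow r).ext ((h.matPow r).smul _) fun i => supPow_mul hc (hd i) r

lemma matPow_one_left (r : ℝ) : matPow (1 : Matrix n n ℂ) r = 1 := by
  have h : Diagonalizes (1 : Matrix n n ℂ) (fun _ => 1) 1 := ⟨by simp, by simp, by simp⟩
  exact (h.matPow r).ext h fun i => supPow_one_left r

lemma Diagonalizes.kronecker {m : Type*} [Fintype m] [DecidableEq m] {U M : Matrix n n ℂ}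
    {V N : Matrix m m ℂ} {d : n → ℝ} {e : m → ℝ} (hM : Diagonalizes U d M)
    (hN : Diagonalizes V e N) :
    Diagonalizes (U ⊗ₖ V) (fun i => d i.1 * e i.2) (M ⊗ₖ N) where
  star_mul := by
    rw [star_eq_conjTranspose, conjTranspose_kronecker, ← mul_kronecker_mul,
      ← star_eq_conjTranspose, ← star_eq_conjTranspose, hM.star_mul, hN.star_mul, one_kronecker_one]
  mul_star := by
    rw [star_eq_conjTranspose, conjTranspose_kronecker, ← mul_kronecker_mul,
      ← star_eq_conjTranspose, ← star_eq_conjTranspose, hM.mul_star, hN.mul_star, one_kronecker_one]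
  eq := by
    conv_lhs => rw [hM.eq, hN.eq]
    simp only [star_eq_conjTranspose, conjTranspose_kronecker, mul_kronecker_mul,
      diagonal_kronecker_diagonal, Complex.ofReal_mul]

lemma matPow_kronecker {m : Type*} [Fintype m] [DecidableEq m] {M : Matrix n n ℂ}
    {N : Matrix m m ℂ} (hM : M.PosSemidef) (hN : N.PosSemidef) (r : ℝ) :
    matPow (M ⊗ₖ N) r = matPow M r ⊗ₖ matPow N r := by
  obtain ⟨U, d, h, hd⟩ := hM.exists_diagonalizes
  obtain ⟨V, e, h', he⟩ := hN.exists_diagonalizes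
  exact ((h.kronecker h').matPow r).ext ((h.matPow r).kronecker (h'.matPow r)) fun i =>
    supPow_mul (hd _) (he _) r

lemma trace_matPow_re {M : Matrix n n ℂ} (hM : M.IsHermitian) (r : ℝ) :
    (matPow M r).trace.re = ∑ i, supPow (hM.eigenvalues i) r :=
  (hM.diagonalizes.matPow r).trace_re

lemma trace_matPow_re_nonneg {M : Matrix n n ℂ} (hM : M.PosSemidef) (r : ℝ) :
    0 ≤ (matPow M r).trace.re := by
  rw [trace_matPow_re hM.isHermitian]
  exact Finset.sum_nonneg fun i _ => supPow_nonneg (hM.eigenvalues_nonneg i) r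

lemma trace_matPow_re_mul_conjTranspose (X : Matrix n n ℂ) (r : ℝ) :
    (matPow (X * Xᴴ) r).trace.re = (matPow (Xᴴ * X) r).trace.re := by
  have h1 := isHermitian_mul_conjTranspose_self X
  have h2 := isHermitian_conjTranspose_mul_self X
  have h := h1.roots_charpoly_eq_eigenvalues
  rw [charpoly_mul_comm, h2.roots_charpoly_eq_eigenvalues] at h
  rw [trace_matPow_re h1, trace_matPow_re h2]
  have := congrArg (fun s => (s.map fun z : ℂ => supPow z.re r).sum) h
  simp only [Multiset.map_map, Function.comp_def, Complex.coe_algebraMap,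
    Complex.ofReal_re] at this
  exact this.symm

lemma Diagonalizes.trace_mul_re {U M : Matrix n n ℂ} {d : n → ℝ} (h : Diagonalizes U d M)
    (X : Matrix n n ℂ) :
    (M * X).trace.re = ∑ i, d i * ((star U * X * U) i i).re := by
  have : (M * X).trace = (diagonal (fun i => (d i : ℂ)) * (star U * X * U)).trace := by
    rw [h.eq, mul_assoc, mul_assoc, trace_mul_comm]
    simp only [mul_assoc]
  rw [this]
  simp [trace, diagonal_mul]

lemma Diagonalizes.conj_apply_re {V N : Matrix n n ℂ} {e : n → ℝ} (h : Diagonalizes V e N)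
    (U : Matrix n n ℂ) (i : n) :
    ((star U * N * U) i i).re = ∑ j, Complex.normSq ((star U * V) i j) * e j := by
  have : star U * N * U = (star U * V) * diagonal (fun i => (e i : ℂ)) * star (star U * V) := by
    rw [h.eq, StarMul.star_mul, star_star]; simp only [mul_assoc]
  rw [this, mul_apply, Complex.re_sum]
  refine Finset.sum_congr rfl fun j _ => ?_
  rw [mul_diagonal, star_apply, Complex.star_def, mul_right_comm, Complex.mul_conj,
    ← Complex.ofReal_mul, Complex.ofReal_re]

lemma sum_normSq_row {W : Matrix n n ℂ} (hW : W * star W = 1) (i : n) :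
    ∑ j, Complex.normSq (W i j) = 1 := by
  have := congrArg Complex.re (congrFun (congrFun hW i) i)
  rw [mul_apply, Complex.re_sum] at this
  simpa [star_apply, Complex.mul_conj] using this

lemma sum_normSq_col {W : Matrix n n ℂ} (hW : star W * W = 1) (j : n) :
    ∑ i, Complex.normSq (W i j) = 1 := by
  have := sum_normSq_row (W := star W) (by rwa [star_star]) j
  simpa [star_apply] using this

lemma star_mul_mul_star_eq_one {U V : Matrix n n ℂ} (hU : star U * U = 1) (hV : V * star V = 1) :
    (star U * V) * star (star U * V) = 1 := by
  rw [star_mul, star_star, mul_assoc, ← mul_assoc V, hV, one_mul, hU]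

/-- Peierls' inequality for powers. -/
lemma sum_conj_diag_rpow_le_trace {N U : Matrix n n ℂ} (hN : N.PosSemidef) (hU : star U * U = 1)
    (hU' : U * star U = 1) {q : ℝ} (hq : 1 ≤ q) :
    ∑ i, ((star U * N * U) i i).re ^ q ≤ (matPow N q).trace.re := by
  obtain ⟨V, e, h, he⟩ := hN.exists_diagonalizes
  have hr := star_mul_mul_star_eq_one hU h.mul_star
  have hc : star (star U * V) * (star U * V) = 1 := by
    simpa using star_mul_mul_star_eq_one h.star_mul hU'
  calc ∑ i, ((star U * N * U) i i).re ^ q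
      ≤ ∑ i, ∑ j, Complex.normSq ((star U * V) i j) * e j ^ q := by
        refine Finset.sum_le_sum fun i _ => ?_
        rw [h.conj_apply_re U i]
        exact Real.rpow_arith_mean_le_arith_mean_rpow _ _ _ (fun _ _ => Complex.normSq_nonneg _)
          (sum_normSq_row hr i) (fun j _ => he j) hq
    _ = ∑ j, e j ^ q := by
        rw [Finset.sum_comm]
        simp_rw [← Finset.sum_mul, sum_normSq_col hc, one_mul]
    _ = (matPow N q).trace.re := by
        rw [(h.matPow q).trace_re]
        simp_rw [supPow_eq_rpow _ (by linarith : q ≠ 0)]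

lemma conj_diag_matPow_le {N U : Matrix n n ℂ} (hN : N.PosSemidef) (hU : star U * U = 1)
    {s : ℝ} (hs : 0 < s) (hs1 : s < 1) (i : n) :
    ((star U * matPow N s * U) i i).re ≤ ((star U * N * U) i i).re ^ s := by
  obtain ⟨V, e, h, he⟩ := hN.exists_diagonalizes
  have hr := star_mul_mul_star_eq_one hU h.mul_star
  rw [h.conj_apply_re, (h.matPow s).conj_apply_re]
  simp_rw [supPow_eq_rpow _ hs.ne']
  simpa using (Real.concaveOn_rpow hs.le hs1.le).le_map_sum (t := Finset.univ)
    (w := fun j => Complex.normSq ((star U * V) i j)) (p := e)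
    (fun _ _ => Complex.normSq_nonneg _) (sum_normSq_row hr i) (fun j _ => he j)

lemma conj_diag_nonneg {N : Matrix n n ℂ} (hN : N.PosSemidef) (U : Matrix n n ℂ) (i : n) :
    0 ≤ ((star U * N * U) i i).re := by
  obtain ⟨V, e, h, he⟩ := hN.exists_diagonalizes
  rw [h.conj_apply_re]
  exact Finset.sum_nonneg fun j _ => mul_nonneg (Complex.normSq_nonneg _) (he j)

/-- Interpolation inequality between the (quasi-)norms of orders `p` and `q`. -/
lemma trace_mul_matPow_le {M C : Matrix n n ℂ} (hM : M.PosSemidef) (hC : C.PosSemidef)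
    {p q s : ℝ} (hp : 0 < p) (hq : 1 ≤ q) (hs : 0 < s) (hs1 : s < 1)
    (hpq : (1 - s) / p + s / q = 1) :
    (M * matPow C s).trace.re ≤ (matPow M p).trace.re ^ ((1 - s) / p) *
      (matPow (matPow C (1 / 2) * M * matPow C (1 / 2)) q).trace.re ^ (s / q) := by
  have hq0 : 0 < q := by linarith
  obtain ⟨U, m, h, hm⟩ := hM.exists_diagonalizes
  set k : n → ℝ := fun i => ((star U * C * U) i i).re with hk
  have hk0 : ∀ i, 0 ≤ k i := conj_diag_nonneg hC U
  have hR := (hM.matPow (1 / 2)).isHermitian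
  have hK := (hC.matPow (1 / 2)).isHermitian
  set R := matPow M (1 / 2) with hRdef
  set K := matPow C (1 / 2) with hKdef
  have hRR : R * R = M := by
    rw [hRdef, matPow_mul_matPow hM, add_halves, matPow_one_right hM]
  have hKK : K * K = C := by
    rw [hKdef, matPow_mul_matPow hC, add_halves, matPow_one_right hC]
  have hN : (R * C * R).PosSemidef := by
    simpa [hR.eq] using hC.mul_mul_conjTranspose_same R
  have htr : (matPow (K * M * K) q).trace.re = (matPow (R * C * R) q).trace.re := by
    have := trace_matPow_re_mul_conjTranspose (K * R) q
    rw [conjTranspose_mul, hR.eq, hK.eq] at this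
    rw [← hRR, ← hKK]
    simpa only [mul_assoc] using this
  have hdiag : ∀ i, ((star U * (R * C * R) * U) i i).re = m i * k i := by
    intro i
    have hRd := h.matPow (1 / 2)
    have e1 : star U * R = diagonal (fun i => (supPow (m i) (1 / 2) : ℂ)) * star U := by
      rw [hRdef, hRd.eq, mul_assoc, ← mul_assoc, h.star_mul, one_mul]
    have e2 : R * U = U * diagonal (fun i => (supPow (m i) (1 / 2) : ℂ)) := by
      rw [hRdef, hRd.eq, mul_assoc, h.star_mul, mul_one]
    have e3 : star U * (R * C * R) * U =
        diagonal (fun i => (supPow (m i) (1 / 2) : ℂ)) * (star U * C * U) *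
          diagonal (fun i => (supPow (m i) (1 / 2) : ℂ)) := by
      calc _ = (star U * R) * C * (R * U) := by simp only [mul_assoc]
        _ = _ := by rw [e1, e2]; simp only [mul_assoc]
    rw [e3, mul_diagonal, diagonal_mul, mul_right_comm, ← Complex.ofReal_mul,
      supPow_mul_supPow (hm i), add_halves, supPow_one_right, Complex.re_ofReal_mul]
  rw [htr, h.trace_mul_re]
  calc ∑ i, m i * ((star U * matPow C s * U) i i).re
      ≤ ∑ i, m i * k i ^ s := Finset.sum_le_sum fun i _ =>
        mul_le_mul_of_nonneg_left (conj_diag_matPow_le hC h.star_mul hs hs1 i) (hm i)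
    _ = ∑ i, (m i ^ p) ^ ((1 - s) / p) * ((m i * k i) ^ q) ^ (s / q) := by
        refine Finset.sum_congr rfl fun i _ => ?_
        rw [← Real.rpow_mul (hm i), ← Real.rpow_mul (mul_nonneg (hm i) (hk0 i)),
          mul_div_cancel₀ _ hp.ne', mul_div_cancel₀ _ hq0.ne', Real.mul_rpow (hm i) (hk0 i),
          ← mul_assoc, ← Real.rpow_add_of_nonneg (hm i) (by linarith) hs.le, sub_add_cancel,
          Real.rpow_one]
    _ ≤ (∑ i, m i ^ p) ^ ((1 - s) / p) * (∑ i, (m i * k i) ^ q) ^ (s / q) :=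
        sum_rpow_mul_rpow_le _ _ _ (fun i _ => Real.rpow_nonneg (hm i) _)
          (fun i _ => Real.rpow_nonneg (mul_nonneg (hm i) (hk0 i)) _)
          (div_pos (by linarith) hp) (div_pos hs hq0) hpq
    _ ≤ _ := by
        have e4 : (matPow M p).trace.re = ∑ i, m i ^ p := by
          rw [(h.matPow p).trace_re]
          simp_rw [supPow_eq_rpow _ hp.ne']
        rw [e4]
        refine mul_le_mul_of_nonneg_left ?_
          (Real.rpow_nonneg (Finset.sum_nonneg fun i _ => Real.rpow_nonneg (hm i) _) _)
        refine Real.rpow_le_rpow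
          (Finset.sum_nonneg fun i _ => Real.rpow_nonneg (mul_nonneg (hm i) (hk0 i)) _) ?_
          (div_pos hs hq0).le
        simpa only [hdiag] using sum_conj_diag_rpow_le_trace hN h.star_mul h.mul_star hq

/-- Variational bound for the quasi-norm of order `β < 1` (reverse Hölder inequality). -/
lemma trace_matPow_le_of_support {R S : Matrix n n ℂ} (hR : R.PosSemidef) (hS : S.PosSemidef)
    (hRS : matPow S 0 * R = R) {β : ℝ} (hβ : 0 < β) (hβ1 : β < 1) :
    (matPow R β).trace.re ≤
      (R * matPow S ((β - 1) / β)).trace.re ^ β * S.trace.re ^ (1 - β) := by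
  obtain ⟨U, r, h, hr⟩ := hR.exists_diagonalizes
  obtain ⟨V, e, h', he⟩ := hS.exists_diagonalizes
  set w : n → n → ℝ := fun i j => Complex.normSq ((star U * V) i j) with hw
  have hw0 : ∀ i j, 0 ≤ w i j := fun i j => Complex.normSq_nonneg _
  have hcol : ∀ j, ∑ i, w i j = 1 := fun j => sum_normSq_col
    (by simpa using star_mul_mul_star_eq_one h'.star_mul h.mul_star) j
  have hsupp : ∀ i, r i * ∑ j, w i j * supPow (e j) 0 = r i := by
    intro i
    have e1 : star U * R * U = diagonal (fun i => (r i : ℂ)) := by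
      conv_lhs => rw [h.eq]
      rw [mul_assoc, mul_assoc, mul_assoc, h.star_mul, mul_one, ← mul_assoc, h.star_mul, one_mul]
    have e2 : (star U * matPow S 0 * U) * diagonal (fun i => (r i : ℂ)) =
        diagonal (fun i => (r i : ℂ)) := by
      rw [← e1]
      calc _ = star U * matPow S 0 * (U * star U) * R * U := by simp only [mul_assoc]
        _ = star U * (matPow S 0 * R) * U := by rw [h.mul_star, mul_one]; simp only [mul_assoc]
        _ = _ := by rw [hRS]
    have := congrArg Complex.re (congrFun (congrFun e2 i) i)
    rw [mul_diagonal, diagonal_apply_eq, Complex.re_mul_ofReal, (h'.matPow 0).conj_apply_re] at this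
    rw [mul_comm]
    exact this
  have hx0 : ∀ i j, 0 ≤ r i * (w i j * supPow (e j) ((β - 1) / β)) := fun i j =>
    mul_nonneg (hr i) (mul_nonneg (hw0 i j) (supPow_nonneg (he j) _))
  have hterm : ∀ i j, supPow (r i) β * (w i j * supPow (e j) 0) =
      (r i * (w i j * supPow (e j) ((β - 1) / β))) ^ β * (w i j * e j) ^ (1 - β) := by
    intro i j
    have h1β : 1 - β ≠ 0 := by linarith
    rw [supPow_eq_rpow _ hβ.ne']
    rcases (he j).eq_or_lt with h0 | hpos
    · rw [← h0]; simp [supPow_zero_left, Real.zero_rpow h1β]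
    · simp only [supPow, hpos.ne', if_false]
      rw [Real.mul_rpow (hr i) (by positivity [hw0 i j]), Real.mul_rpow (hw0 i j) (by positivity),
        Real.mul_rpow (hw0 i j) hpos.le, ← Real.rpow_mul hpos.le, div_mul_cancel₀ _ hβ.ne']
      have e1 : w i j ^ β * w i j ^ (1 - β) = w i j := by
        rw [← Real.rpow_add_of_nonneg (hw0 i j) hβ.le (by linarith), add_sub_cancel, Real.rpow_one]
      have e2 : e j ^ (β - 1) * e j ^ (1 - β) = e j ^ (0 : ℝ) := by
        rw [← Real.rpow_add hpos]; congr 1; ring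
      calc r i ^ β * (w i j * e j ^ (0 : ℝ))
          = r i ^ β * ((w i j ^ β * w i j ^ (1 - β)) * (e j ^ (β - 1) * e j ^ (1 - β))) := by
            rw [e1, e2]
        _ = _ := by ring
  have hsum : ∀ f : n → n → ℝ, ∑ i, ∑ j, f i j = ∑ x : n × n, f x.1 x.2 := fun f =>
    (Fintype.sum_prod_type' f).symm
  calc (matPow R β).trace.re = ∑ i, ∑ j, supPow (r i) β * (w i j * supPow (e j) 0) := by
        rw [(h.matPow β).trace_re]
        refine Finset.sum_congr rfl fun i _ => ?_
        rw [← Finset.mul_sum]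
        by_cases h0 : r i = 0
        · simp [h0, supPow_zero_left]
        · rw [mul_left_cancel₀ h0 ((hsupp i).trans (mul_one _).symm), mul_one]
    _ = ∑ x : n × n, (r x.1 * (w x.1 x.2 * supPow (e x.2) ((β - 1) / β))) ^ β *
          (w x.1 x.2 * e x.2) ^ (1 - β) := by
        rw [hsum]; exact Finset.sum_congr rfl fun x _ => hterm _ _
    _ ≤ (∑ x : n × n, r x.1 * (w x.1 x.2 * supPow (e x.2) ((β - 1) / β))) ^ β *
          (∑ x : n × n, w x.1 x.2 * e x.2) ^ (1 - β) :=
        sum_rpow_mul_rpow_le _ _ _ (fun x _ => hx0 _ _)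
          (fun x _ => mul_nonneg (hw0 _ _) (he _)) hβ (by linarith) (by ring)
    _ = _ := by
        rw [← hsum fun i j => r i * (w i j * supPow (e j) ((β - 1) / β)),
          ← hsum fun i j => w i j * e j, h.trace_mul_re, h'.trace_re]
        congr 2
        · refine Finset.sum_congr rfl fun i _ => ?_
          rw [(h'.matPow _).conj_apply_re, ← Finset.mul_sum]
        · rw [Finset.sum_comm]
          simp_rw [← Finset.sum_mul, hcol, one_mul]

lemma mul_eq_zero_of_trace_mul_eq_zero {M N : Matrix n n ℂ} (hM : M.PosSemidef)
    (hN : N.PosSemidef) (h : (M * N).trace = 0) : M * N = 0 := by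
  have hR := (hM.matPow (1 / 2)).isHermitian
  have hK := (hN.matPow (1 / 2)).isHermitian
  set R := matPow M (1 / 2) with hRdef
  set K := matPow N (1 / 2) with hKdef
  have hRR : R * R = M := by
    rw [hRdef, matPow_mul_matPow hM, add_halves, matPow_one_right hM]
  have hKK : K * K = N := by
    rw [hKdef, matPow_mul_matPow hN, add_halves, matPow_one_right hN]
  have h0 : R * K = 0 := by
    rw [← trace_conjTranspose_mul_self_eq_zero_iff, conjTranspose_mul, hR.eq, hK.eq, ← h, ← hRR,
      ← hKK, mul_assoc K, trace_mul_comm K]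
    simp only [mul_assoc]
  calc M * N = R * (R * K) * K := by rw [← hRR, ← hKK]; simp only [mul_assoc]
    _ = 0 := by rw [h0]; simp

lemma matPow_zero_mul_of_dominates {S R : Matrix n n ℂ} (hS : S.PosSemidef) (hR : R.PosSemidef)
    (h : Dominates S R) : matPow S 0 * R = R := by
  have h0 : S * (1 - matPow S 0) = 0 := by
    have := matPow_mul_matPow hS 1 0
    rw [matPow_one_right hS, add_zero, matPow_one_right hS] at this
    rw [mul_sub, mul_one, this, sub_self]
  have h1 : R * (1 - matPow S 0) = 0 := by
    ext i j
    have hv : S.mulVec ((1 - matPow S 0).col j) = 0 := by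
      ext k; exact congrFun (congrFun h0 k) j
    exact congrFun (h _ hv) i
  have h2 := congrArg conjTranspose h1
  rw [conjTranspose_mul, conjTranspose_sub, conjTranspose_one, conjTranspose_zero,
    (hS.matPow 0).isHermitian.eq, hR.isHermitian.eq, sub_mul, one_mul, sub_eq_zero] at h2
  exact h2.symm

lemma trace_mul_ne_zero_of_support {S R : Matrix n n ℂ} (hS : S.PosSemidef) (hR : R.PosSemidef)
    (h : matPow S 0 * R = R) (hR0 : R ≠ 0) : (R * S).trace ≠ 0 := by
  intro h0
  have h1 := mul_eq_zero_of_trace_mul_eq_zero hR hS h0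
  have h2 := congrArg conjTranspose h
  rw [conjTranspose_mul, (hS.matPow 0).isHermitian.eq, hR.isHermitian.eq] at h2
  have h3 := matPow_mul_matPow hS 1 (-1)
  rw [matPow_one_right hS, add_neg_cancel] at h3
  exact hR0 (by rw [← h2, ← h3, ← mul_assoc, h1, zero_mul])

lemma trace_matPow_re_pos {M : Matrix n n ℂ} (hM : IsDensity M) (r : ℝ) :
    0 < (matPow M r).trace.re := by
  have h := hM.1.isHermitian
  have h1 : ∑ i, h.eigenvalues i = 1 := by
    rw [← h.diagonalizes.trace_re, hM.2, Complex.one_re]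
  rw [trace_matPow_re h]
  refine Finset.sum_pos' (fun i _ => supPow_nonneg (hM.1.eigenvalues_nonneg i) r) ?_
  by_contra! hle
  have h0 : ∀ i, h.eigenvalues i = 0 := by
    intro i
    by_contra hne
    have hpos := lt_of_le_of_ne (hM.1.eigenvalues_nonneg i) (Ne.symm hne)
    have := hle i (Finset.mem_univ i)
    rw [supPow, if_neg hne] at this
    exact absurd (Real.rpow_pos_of_pos hpos r) (not_lt.2 this)
  simp [h0] at h1

variable {A B : Type*} [Fintype A] [Fintype B]

lemma margSnd_posSemidef {ρ : Matrix (A × B) (A × B) ℂ} (hρ : ρ.PosSemidef) :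
    (margSnd ρ).PosSemidef := by
  have : margSnd ρ = ∑ a : A, ρ.submatrix (fun b => (a, b)) (fun b => (a, b)) := by
    ext b b'; simp [margSnd, Matrix.sum_apply]
  rw [this]
  exact posSemidef_sum _ fun a _ => hρ.submatrix _

lemma margFst_posSemidef {ρ : Matrix (A × B) (A × B) ℂ} (hρ : ρ.PosSemidef) :
    (margFst ρ).PosSemidef := by
  have : margFst ρ = ∑ b : B, ρ.submatrix (fun a => (a, b)) (fun a => (a, b)) := by
    ext b b'; simp [margFst, Matrix.sum_apply]
  rw [this]
  exact posSemidef_sum _ fun a _ => hρ.submatrix _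

lemma trace_margSnd (ρ : Matrix (A × B) (A × B) ℂ) : (margSnd ρ).trace = ρ.trace := by
  simp [trace, margSnd, Fintype.sum_prod_type_right]

lemma trace_margFst (ρ : Matrix (A × B) (A × B) ℂ) : (margFst ρ).trace = ρ.trace := by
  simp [trace, margFst, Fintype.sum_prod_type]

lemma IsDensity.margSnd {ρ : Matrix (A × B) (A × B) ℂ} (hρ : IsDensity ρ) :
    IsDensity (margSnd ρ) :=
  ⟨margSnd_posSemidef hρ.1, (trace_margSnd ρ).trans hρ.2⟩

lemma IsDensity.margFst {ρ : Matrix (A × B) (A × B) ℂ} (hρ : IsDensity ρ) :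
    IsDensity (margFst ρ) :=
  ⟨margFst_posSemidef hρ.1, (trace_margFst ρ).trans hρ.2⟩

variable [DecidableEq A]

lemma margSnd_one_kronecker_mul (X : Matrix B B ℂ) (ρ : Matrix (A × B) (A × B) ℂ) :
    margSnd (((1 : Matrix A A ℂ) ⊗ₖ X) * ρ) = X * margSnd ρ := by
  ext b b'
  simp only [margSnd, mul_apply, of_apply, kronecker_apply, one_apply, Fintype.sum_prod_type,
    ite_mul, one_mul, zero_mul, Finset.sum_ite_irrel, Finset.sum_const_zero, Finset.sum_ite_eq,
    Finset.mem_univ, if_true, Finset.mul_sum]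
  exact Finset.sum_comm

lemma trace_mul_one_kronecker (ρ : Matrix (A × B) (A × B) ℂ) (X : Matrix B B ℂ) :
    (ρ * ((1 : Matrix A A ℂ) ⊗ₖ X)).trace = (margSnd ρ * X).trace := by
  rw [trace_mul_comm, ← trace_margSnd, margSnd_one_kronecker_mul, trace_mul_comm]

variable [DecidableEq B]

lemma one_kronecker_matPow_zero_mul {ρ : Matrix (A × B) (A × B) ℂ} (hρ : ρ.PosSemidef) :
    ((1 : Matrix A A ℂ) ⊗ₖ matPow (margSnd ρ) 0) * ρ = ρ := by
  have hB := margSnd_posSemidef hρ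
  have hP := hB.matPow 0
  set P := matPow (margSnd ρ) 0 with hPdef
  have hPP : P * P = P := by rw [hPdef, matPow_mul_matPow hB, add_zero]
  have hPB : P * margSnd ρ = margSnd ρ := by
    have := matPow_mul_matPow hB 0 1
    rwa [matPow_one_right hB, zero_add, matPow_one_right hB] at this
  have hQ : (1 - P).PosSemidef := by
    have : (1 - P)ᴴ * (1 - P) = 1 - P := by
      rw [conjTranspose_sub, conjTranspose_one, hP.isHermitian.eq]
      simp [mul_sub, sub_mul, hPP]
    rw [← this]
    exact posSemidef_conjTranspose_mul_self _
  have hQ' : ((1 : Matrix A A ℂ) ⊗ₖ (1 - P)).PosSemidef := PosSemidef.one.kronecker hQ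
  have h0 : ((1 : Matrix A A ℂ) ⊗ₖ (1 - P)) * ρ = 0 := by
    refine mul_eq_zero_of_trace_mul_eq_zero hQ' hρ ?_
    rw [trace_mul_comm, trace_mul_one_kronecker, trace_mul_comm, sub_mul, one_mul, hPB, sub_self,
      trace_zero]
  have h1 : ((1 : Matrix A A ℂ) ⊗ₖ (1 - P)) = 1 - (1 : Matrix A A ℂ) ⊗ₖ P := by
    rw [eq_sub_iff_add_eq, ← kronecker_add, sub_add_cancel, one_kronecker_one]
  rw [h1, sub_mul, one_mul, sub_eq_zero] at h0
  exact h0.symm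

lemma trace_mul_kronecker_matPow_le {ρ : Matrix (A × B) (A × B) ℂ} {τ : Matrix A A ℂ}
    {σ : Matrix B B ℂ} (hρ : ρ.PosSemidef) (hτ : τ.PosSemidef) (hσ : σ.PosSemidef)
    {p q s : ℝ} (hp : 0 < p) (hq : 1 ≤ q) (hs : 0 < s) (hs1 : s < 1)
    (hpq : (1 - s) / p + s / q = 1) (x₁ x₂ y₁ y₂ : ℝ) :
    (ρ * (matPow τ (2 * ((1 - s) * x₁ + s * x₂)) ⊗ₖ
        matPow σ (2 * ((1 - s) * y₁ + s * y₂)))).trace.re ≤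
      (matPow ((matPow τ x₁ ⊗ₖ matPow σ y₁) * ρ * (matPow τ x₁ ⊗ₖ matPow σ y₁)) p).trace.re ^
          ((1 - s) / p) *
        (matPow ((matPow τ x₂ ⊗ₖ matPow σ y₂) * ρ * (matPow τ x₂ ⊗ₖ matPow σ y₂)) q).trace.re ^
          (s / q) := by
  set K := matPow τ x₁ ⊗ₖ matPow σ y₁ with hK
  set C := matPow τ (2 * (x₂ - x₁)) ⊗ₖ matPow σ (2 * (y₂ - y₁)) with hC
  have hKP : K.PosSemidef := (hτ.matPow _).kronecker (hσ.matPow _)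
  have hCP : C.PosSemidef := (hτ.matPow _).kronecker (hσ.matPow _)
  have hM : (K * ρ * K).PosSemidef := by
    simpa [hKP.isHermitian.eq] using hρ.mul_mul_conjTranspose_same K
  have hCpow : ∀ r, matPow C r =
      matPow τ (2 * (x₂ - x₁) * r) ⊗ₖ matPow σ (2 * (y₂ - y₁) * r) := fun r => by
    rw [hC, matPow_kronecker (hτ.matPow _) (hσ.matPow _), matPow_matPow hτ, matPow_matPow hσ]
  have e1 : matPow C (1 / 2) * K = matPow τ x₂ ⊗ₖ matPow σ y₂ := by
    rw [hCpow, hK, ← mul_kronecker_mul, matPow_mul_matPow hτ, matPow_mul_matPow hσ]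
    congr 2 <;> ring
  have e2 : K * matPow C (1 / 2) = matPow τ x₂ ⊗ₖ matPow σ y₂ := by
    rw [hCpow, hK, ← mul_kronecker_mul, matPow_mul_matPow hτ, matPow_mul_matPow hσ]
    congr 2 <;> ring
  have e3 : K * matPow C s * K = matPow τ (2 * ((1 - s) * x₁ + s * x₂)) ⊗ₖ
      matPow σ (2 * ((1 - s) * y₁ + s * y₂)) := by
    rw [hCpow, hK, ← mul_kronecker_mul, ← mul_kronecker_mul, matPow_mul_matPow hτ,
      matPow_mul_matPow hσ, matPow_mul_matPow hτ, matPow_mul_matPow hσ]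
    congr 2 <;> ring
  have key := trace_mul_matPow_le hM hCP hp hq hs hs1 hpq
  have e4 : (K * ρ * K * matPow C s).trace = (ρ * (K * matPow C s * K)).trace := by
    rw [mul_assoc, mul_assoc, trace_mul_comm]
    simp only [mul_assoc]
  have e5 : matPow C (1 / 2) * (K * ρ * K) * matPow C (1 / 2) =
      (matPow C (1 / 2) * K) * ρ * (K * matPow C (1 / 2)) := by
    simp only [mul_assoc]
  rwa [e4, e3, e5, e1, e2] at key

/-- The two sandwiched expressions agree when the second tensor factor only acts through the
support projection of `σ`. -/
lemma sandwich_kronecker_zero {ρ : Matrix (A × B) (A × B) ℂ} (hρ : ρ.PosSemidef)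
    {τ : Matrix A A ℂ} {σ : Matrix B B ℂ} (hτ : τ.PosSemidef) (hσ : σ.PosSemidef)
    (h : ((1 : Matrix A A ℂ) ⊗ₖ matPow σ 0) * ρ = ρ) (x : ℝ) :
    (matPow τ x ⊗ₖ matPow σ 0) * ρ * (matPow τ x ⊗ₖ matPow σ 0) =
      matPow (τ ⊗ₖ (1 : Matrix B B ℂ)) x * ρ * matPow (τ ⊗ₖ (1 : Matrix B B ℂ)) x := by
  have e : matPow τ x ⊗ₖ matPow σ 0 =
      (matPow τ x ⊗ₖ (1 : Matrix B B ℂ)) * ((1 : Matrix A A ℂ) ⊗ₖ matPow σ 0) := by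
    rw [← mul_kronecker_mul, mul_one, one_mul]
  have h1 : (matPow τ x ⊗ₖ matPow σ 0) * ρ = (matPow τ x ⊗ₖ (1 : Matrix B B ℂ)) * ρ := by
    rw [e, mul_assoc, h]
  have h2 := congrArg conjTranspose h1
  simp only [conjTranspose_mul, conjTranspose_kronecker, (hτ.matPow x).isHermitian.eq,
    (hσ.matPow 0).isHermitian.eq, hρ.isHermitian.eq, conjTranspose_one] at h2
  rw [matPow_kronecker hτ PosSemidef.one, matPow_one_left, h1, mul_assoc, h2, ← mul_assoc]

lemma one_kronecker_mul_eq_of_kronecker {ρ : Matrix (A × B) (A × B) ℂ} {τ : Matrix A A ℂ}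
    {σ : Matrix B B ℂ} (hτ : τ.PosSemidef) (hσ : σ.PosSemidef)
    (h : (matPow τ 0 ⊗ₖ matPow σ 0) * ρ = ρ) :
    ((1 : Matrix A A ℂ) ⊗ₖ matPow σ 0) * ρ = ρ ∧
      (matPow τ 0 ⊗ₖ (1 : Matrix B B ℂ)) * ρ = ρ := by
  constructor
  · nth_rw 1 [← h]
    rw [← mul_assoc, ← mul_kronecker_mul, one_mul, matPow_mul_matPow hσ, add_zero, h]
  · nth_rw 1 [← h]
    rw [← mul_assoc, ← mul_kronecker_mul, one_mul, matPow_mul_matPow hτ, add_zero, h]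

lemma trace_mul_kronecker_zero {ρ : Matrix (A × B) (A × B) ℂ} {τ : Matrix A A ℂ}
    (h : (matPow τ 0 ⊗ₖ (1 : Matrix B B ℂ)) * ρ = ρ) (X : Matrix B B ℂ) :
    (ρ * (matPow τ 0 ⊗ₖ X)).trace = (margSnd ρ * X).trace := by
  have e : matPow τ 0 ⊗ₖ X = (1 ⊗ₖ X) * (matPow τ 0 ⊗ₖ (1 : Matrix B B ℂ)) := by
    rw [← mul_kronecker_mul, mul_one, one_mul]
  rw [e, ← mul_assoc, trace_mul_comm, ← mul_assoc, h, trace_mul_one_kronecker]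

/-- The core interpolation estimate, with the marginal on `B` against a power of `σ`. -/
lemma trace_margSnd_mul_matPow_le {ρ : Matrix (A × B) (A × B) ℂ} {τ : Matrix A A ℂ}
    {σ : Matrix B B ℂ} (hρ : ρ.PosSemidef) (hτ : τ.PosSemidef) (hσ : σ.PosSemidef)
    (h : (matPow τ 0 ⊗ₖ matPow σ 0) * ρ = ρ)
    {p q s : ℝ} (hp : 0 < p) (hq : 1 ≤ q) (hs : 0 < s) (hs1 : s < 1)
    (hpq : (1 - s) / p + s / q = 1) {x₁ x₂ y₁ y₂ z : ℝ} (hx : (1 - s) * x₁ + s * x₂ = 0)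
    (hy : 2 * ((1 - s) * y₁ + s * y₂) = z) :
    (margSnd ρ * matPow σ z).trace.re ≤
      (matPow ((matPow τ x₁ ⊗ₖ matPow σ y₁) * ρ * (matPow τ x₁ ⊗ₖ matPow σ y₁)) p).trace.re ^
          ((1 - s) / p) *
        (matPow ((matPow τ x₂ ⊗ₖ matPow σ y₂) * ρ * (matPow τ x₂ ⊗ₖ matPow σ y₂)) q).trace.re ^
          (s / q) := by
  have key := trace_mul_kronecker_matPow_le hρ hτ hσ hp hq hs hs1 hpq x₁ x₂ y₁ y₂
  rwa [hx, mul_zero, hy,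
    trace_mul_kronecker_zero (one_kronecker_mul_eq_of_kronecker hτ hσ h).2] at key

lemma trace_mul_re_nonneg {M N : Matrix n n ℂ} (hM : M.PosSemidef) (hN : N.PosSemidef) :
    0 ≤ (M * N).trace.re := by
  obtain ⟨U, d, h, hd⟩ := hM.exists_diagonalizes
  rw [h.trace_mul_re]
  exact Finset.sum_nonneg fun i _ => mul_nonneg (hd i) (conj_diag_nonneg hN U i)

lemma logb_le_of_le_rpow_mul_rpow {x y z u v : ℝ} (hx : 0 < x) (hy : 0 ≤ y) (hz : 0 ≤ z)
    (hu : 0 < u) (hv : 0 < v) (h : x ≤ y ^ u * z ^ v) :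
    Real.logb 2 x ≤ u * Real.logb 2 y + v * Real.logb 2 z := by
  have hpos := hx.trans_le h
  have hy0 : 0 < y := hy.lt_of_ne fun h0 => by
    rw [← h0, Real.zero_rpow hu.ne', zero_mul] at hpos; exact lt_irrefl _ hpos
  have hz0 : 0 < z := hz.lt_of_ne fun h0 => by
    rw [← h0, Real.zero_rpow hv.ne', mul_zero] at hpos; exact lt_irrefl _ hpos
  have := Real.logb_le_logb_of_le one_lt_two hx h
  rwa [Real.logb_mul (Real.rpow_pos_of_pos hy0 u).ne' (Real.rpow_pos_of_pos hz0 v).ne',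
    Real.logb_rpow_eq_mul_logb_of_pos hy0, Real.logb_rpow_eq_mul_logb_of_pos hz0] at this

lemma trace_sandwich_re_nonneg {ρ K : Matrix n n ℂ} (hρ : ρ.PosSemidef) (hK : K.PosSemidef)
    (r : ℝ) : 0 ≤ (matPow (K * ρ * K) r).trace.re := by
  refine trace_matPow_re_nonneg ?_ r
  simpa [hK.isHermitian.eq] using hρ.mul_mul_conjTranspose_same K

lemma IsDensity.ne_zero {ρ : Matrix n n ℂ} (hρ : IsDensity ρ) : ρ ≠ 0 := by
  rintro rfl
  simpa using hρ.2

lemma renyiEntropy_add_renyiDiv_le {ρ : Matrix (A × B) (A × B) ℂ} (hρ : IsDensity ρ)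
    {τ : Matrix A A ℂ} (hτ : IsDensity τ) {σ : Matrix B B ℂ} (hσ : IsDensity σ) {α β γ : ℝ}
    (hrel : α / (α - 1) = β / (β - 1) + γ / (γ - 1)) (hα : 0 < α) (hα1 : α < 1)
    (hβ : 0 < β) (hβ1 : β < 1) (hγ : 1 < γ) :
    (renyiEntropy β (margSnd ρ) : EReal) + renyiDiv α ρ (τ ⊗ₖ (1 : Matrix B B ℂ)) ≤
      renyiDiv γ ρ (τ ⊗ₖ σ) := by
  by_cases hfin : (ρ * (τ ⊗ₖ σ)).trace ≠ 0 ∧ (Dominates (τ ⊗ₖ σ) ρ ∨ γ < 1)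
  swap
  · rw [renyiDiv.eq_def γ, if_neg hfin]; exact le_top
  have hsupp := matPow_zero_mul_of_dominates (hτ.1.kronecker hσ.1) hρ.1
    (hfin.2.resolve_right hγ.not_gt)
  rw [matPow_kronecker hτ.1 hσ.1] at hsupp
  obtain ⟨hsB, hsA⟩ := one_kronecker_mul_eq_of_kronecker hτ.1 hσ.1 hsupp
  have hfin' : (ρ * (τ ⊗ₖ (1 : Matrix B B ℂ))).trace ≠ 0 ∧
      (Dominates (τ ⊗ₖ (1 : Matrix B B ℂ)) ρ ∨ α < 1) := by
    refine ⟨trace_mul_ne_zero_of_support (hτ.1.kronecker PosSemidef.one) hρ.1 ?_ hρ.ne_zero,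
      Or.inr hα1⟩
    rw [matPow_kronecker hτ.1 PosSemidef.one, matPow_one_left, hsA]
  rw [renyiDiv, renyiDiv, if_pos hfin, if_pos hfin', renyiEntropy, ← EReal.coe_add,
    EReal.coe_le_coe_iff]
  have hσB : matPow σ 0 * margSnd ρ = margSnd ρ := by
    rw [← margSnd_one_kronecker_mul, hsB]
  obtain ⟨a, ha⟩ : ∃ a, a = α / (1 - α) := ⟨_, rfl⟩
  obtain ⟨b, hb⟩ : ∃ b, b = β / (1 - β) := ⟨_, rfl⟩
  obtain ⟨c, hc⟩ : ∃ c, c = γ / (γ - 1) := ⟨_, rfl⟩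
  have h1α : 0 < 1 - α := by linarith
  have h1β : 0 < 1 - β := by linarith
  have h1γ : 0 < γ - 1 := by linarith
  have hγ0 : 0 < γ := by linarith
  have ha0 : 0 < a := by rw [ha]; positivity
  have hb0 : 0 < b := by rw [hb]; positivity
  have hc0 : 0 < c := by rw [hc]; positivity
  have hbac : b = a + c := by
    rw [ha, hb, hc]
    rw [← neg_sub 1 α, ← neg_sub 1 β, div_neg, div_neg] at hrel
    linarith
  have hs : 1 - c / b = a / b := by rw [hbac]; field_simp; ring
  have hα' : 1 / α = 1 + 1 / a := by rw [ha]; field_simp; ring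
  have hγ' : 1 / γ = 1 - 1 / c := by rw [hc]; field_simp; ring
  have hx1 : (1 - α) / (2 * α) = 1 / (2 * a) := by rw [ha]; field_simp
  have hx2 : (1 - γ) / (2 * γ) = -(1 / (2 * c)) := by rw [hc]; field_simp; ring
  have hz : (β - 1) / β = -(1 / b) := by rw [hb]; field_simp; ring
  have key := trace_margSnd_mul_matPow_le (p := α) (q := γ) (s := c / b) (x₁ := (1 - α) / (2 * α))
    (x₂ := (1 - γ) / (2 * γ)) (y₁ := 0) (y₂ := (1 - γ) / (2 * γ)) (z := (β - 1) / β)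
    hρ.1 hτ.1 hσ.1 hsupp hα hγ.le (div_pos hc0 hb0) (by rw [div_lt_one hb0]; linarith)
    (by
      rw [hs, div_eq_mul_one_div _ α, div_eq_mul_one_div _ γ, hα', hγ', hbac]
      field_simp; ring)
    (by rw [hs, hx1, hx2]; field_simp; ring)
    (by rw [hs, hx2, hz]; field_simp; ring)
  rw [sandwich_kronecker_zero hρ.1 hτ.1 hσ.1 hsB, ← matPow_kronecker hτ.1 hσ.1] at key
  have hvar := trace_matPow_le_of_support hρ.margSnd.1 hσ.1 hσB hβ hβ1
  rw [hσ.2, Complex.one_re, Real.one_rpow, mul_one] at hvar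
  have hB := trace_matPow_re_pos hρ.margSnd β
  have hY := trace_sandwich_re_nonneg hρ.1
    ((hτ.1.kronecker (PosSemidef.one (n := B) (R := ℂ))).matPow ((1 - α) / (2 * α))) α
  have hZ := trace_sandwich_re_nonneg hρ.1
    ((hτ.1.kronecker hσ.1).matPow ((1 - γ) / (2 * γ))) γ
  have hX := trace_mul_re_nonneg hρ.margSnd.1 (hσ.1.matPow ((β - 1) / β))
  revert key hvar hB hY hZ hX
  generalize (matPow (margSnd ρ) β).trace.re = TB
  generalize (matPow (matPow (τ ⊗ₖ (1 : Matrix B B ℂ)) ((1 - α) / (2 * α)) * ρ *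
    matPow (τ ⊗ₖ (1 : Matrix B B ℂ)) ((1 - α) / (2 * α))) α).trace.re = Y
  generalize (matPow (matPow (τ ⊗ₖ σ) ((1 - γ) / (2 * γ)) * ρ *
    matPow (τ ⊗ₖ σ) ((1 - γ) / (2 * γ))) γ).trace.re = Z
  generalize (margSnd ρ * matPow σ ((β - 1) / β)).trace.re = X
  intro key hvar hB hY hZ hX
  have hle : TB ≤ Y ^ ((1 - c / b) / α * β) * Z ^ (c / b / γ * β) := by
    rw [Real.rpow_mul hY, Real.rpow_mul hZ, ← Real.mul_rpow (by positivity) (by positivity)]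
    exact hvar.trans (Real.rpow_le_rpow hX key hβ.le)
  have hlog := logb_le_of_le_rpow_mul_rpow hB hY hZ (by rw [hs]; positivity) (by positivity) hle
  have hlog' := mul_le_mul_of_nonneg_left hlog (inv_nonneg.2 h1β.le)
  have e1 : (1 - β)⁻¹ * ((1 - c / b) / α * β) = -(α - 1)⁻¹ := by
    rw [hs, ← inv_neg, neg_sub]
    have : (1 - β)⁻¹ * β = b := by rw [hb, inv_mul_eq_div]
    calc _ = ((1 - β)⁻¹ * β) * (a / b) / α := by ring
      _ = a / α := by rw [this]; field_simp
      _ = _ := by rw [ha]; field_simp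
  have e2 : (1 - β)⁻¹ * (c / b / γ * β) = (γ - 1)⁻¹ := by
    have : (1 - β)⁻¹ * β = b := by rw [hb, inv_mul_eq_div]
    calc _ = ((1 - β)⁻¹ * β) * (c / b) / γ := by ring
      _ = c / γ := by rw [this]; field_simp
      _ = _ := by rw [hc]; field_simp
  rw [mul_add, ← mul_assoc _ _ (Real.logb 2 Y), ← mul_assoc _ _ (Real.logb 2 Z), e1, e2] at hlog'
  linarith

lemma exists_renyiDiv_le_renyiEntropy_add {ρ : Matrix (A × B) (A × B) ℂ} (hρ : IsDensity ρ)
    {τ : Matrix A A ℂ} (hτ : IsDensity τ) {α β γ : ℝ}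
    (hrel : α / (α - 1) = β / (β - 1) + γ / (γ - 1)) (hα : 1 < α)
    (hβ : 1 < β) (hγ : 0 < γ) (hγ1 : γ < 1) :
    ∃ σ : Matrix B B ℂ, IsDensity σ ∧ renyiDiv γ ρ (τ ⊗ₖ σ) ≤
      (renyiEntropy β (margSnd ρ) : EReal) + renyiDiv α ρ (τ ⊗ₖ (1 : Matrix B B ℂ)) := by
  have hBd := hρ.margSnd
  by_cases hfin : (ρ * (τ ⊗ₖ (1 : Matrix B B ℂ))).trace ≠ 0 ∧
      (Dominates (τ ⊗ₖ (1 : Matrix B B ℂ)) ρ ∨ α < 1)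
  swap
  · refine ⟨margSnd ρ, hBd, ?_⟩
    rw [renyiDiv.eq_def α, if_neg hfin, EReal.coe_add_top]
    exact le_top
  have hB := trace_matPow_re_pos hBd β
  obtain ⟨T, hT⟩ : ∃ T, T = (matPow (margSnd ρ) β).trace.re := ⟨_, rfl⟩
  rw [← hT] at hB
  have hβ0 : 0 < β := by linarith
  obtain ⟨σ, hσdef⟩ : ∃ σ, σ = ((T⁻¹ : ℝ) : ℂ) • matPow (margSnd ρ) β := ⟨_, rfl⟩
  have hσ : IsDensity σ := by
    refine ⟨hσdef ▸ (hBd.1.matPow β).smul (by simpa using hB.le), ?_⟩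
    have him : ((matPow (margSnd ρ) β).trace : ℂ) = (T : ℂ) := by
      have := (hBd.1.matPow β).trace_nonneg
      rw [Complex.le_def] at this
      apply Complex.ext
      · rw [Complex.ofReal_re, hT]
      · rw [Complex.ofReal_im]; exact this.2.symm
    rw [hσdef, trace_smul, him, smul_eq_mul, ← Complex.ofReal_mul, inv_mul_cancel₀ hB.ne',
      Complex.ofReal_one]
  have hσpow : ∀ r, matPow σ r = ((supPow T⁻¹ r : ℝ) : ℂ) • matPow (margSnd ρ) (β * r) := fun r => by
    rw [hσdef, matPow_smul (hBd.1.matPow β) (inv_nonneg.2 hB.le), matPow_matPow hBd.1]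
  have hσ0 : matPow σ 0 = matPow (margSnd ρ) 0 := by
    rw [hσpow, mul_zero, supPow, if_neg (inv_ne_zero hB.ne'), Real.rpow_zero, Complex.ofReal_one,
      one_smul]
  have hsB : ((1 : Matrix A A ℂ) ⊗ₖ matPow σ 0) * ρ = ρ := by
    rw [hσ0, one_kronecker_matPow_zero_mul hρ.1]
  have hsA := matPow_zero_mul_of_dominates (hτ.1.kronecker PosSemidef.one) hρ.1
    (hfin.2.resolve_right hα.not_gt)
  rw [matPow_kronecker hτ.1 PosSemidef.one, matPow_one_left] at hsA
  have hsupp : (matPow τ 0 ⊗ₖ matPow σ 0) * ρ = ρ := by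
    have : matPow τ 0 ⊗ₖ matPow σ 0 =
        (matPow τ 0 ⊗ₖ (1 : Matrix B B ℂ)) * ((1 : Matrix A A ℂ) ⊗ₖ matPow σ 0) := by
      rw [← mul_kronecker_mul, mul_one, one_mul]
    rw [this, mul_assoc, hsB, hsA]
  have hfin' : (ρ * (τ ⊗ₖ σ)).trace ≠ 0 ∧ (Dominates (τ ⊗ₖ σ) ρ ∨ γ < 1) := by
    refine ⟨trace_mul_ne_zero_of_support (hτ.1.kronecker hσ.1) hρ.1 ?_ hρ.ne_zero, Or.inr hγ1⟩
    rw [matPow_kronecker hτ.1 hσ.1, hsupp]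
  refine ⟨σ, hσ, ?_⟩
  rw [renyiDiv, renyiDiv, if_pos hfin, if_pos hfin', renyiEntropy, ← EReal.coe_add,
    EReal.coe_le_coe_iff]
  obtain ⟨a, ha⟩ : ∃ a, a = α / (α - 1) := ⟨_, rfl⟩
  obtain ⟨b, hb⟩ : ∃ b, b = β / (β - 1) := ⟨_, rfl⟩
  obtain ⟨c, hc⟩ : ∃ c, c = γ / (1 - γ) := ⟨_, rfl⟩
  have h1α : 0 < α - 1 := by linarith
  have h1β : 0 < β - 1 := by linarith
  have h1γ : 0 < 1 - γ := by linarith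
  have hα0 : 0 < α := by linarith
  have ha0 : 0 < a := by rw [ha]; positivity
  have hb0 : 0 < b := by rw [hb]; positivity
  have hc0 : 0 < c := by rw [hc]; positivity
  have hbac : b = a + c := by
    rw [ha, hb, hc]
    rw [← neg_sub 1 γ, div_neg] at hrel
    linarith
  have hs : 1 - a / b = c / b := by rw [hbac]; field_simp; ring
  have hα' : 1 / α = 1 - 1 / a := by rw [ha]; field_simp; ring
  have hγ' : 1 / γ = 1 + 1 / c := by rw [hc]; field_simp; ring
  have hx1 : (1 - γ) / (2 * γ) = 1 / (2 * c) := by rw [hc]; field_simp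
  have hx2 : (1 - α) / (2 * α) = -(1 / (2 * a)) := by rw [ha]; field_simp; ring
  have hz : (β - 1) / β = 1 / b := by rw [hb]; field_simp
  have key := trace_margSnd_mul_matPow_le (p := γ) (q := α) (s := a / b) (x₁ := (1 - γ) / (2 * γ))
    (x₂ := (1 - α) / (2 * α)) (y₁ := (1 - γ) / (2 * γ)) (y₂ := 0) (z := (β - 1) / β)
    hρ.1 hτ.1 hσ.1 hsupp hγ hα.le (div_pos ha0 hb0) (by rw [div_lt_one hb0]; linarith)
    (by
      rw [hs, div_eq_mul_one_div _ α, div_eq_mul_one_div _ γ, hα', hγ', hbac]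
      field_simp; ring)
    (by rw [hs, hx1, hx2]; field_simp; ring)
    (by rw [hs, hx1, hz]; field_simp; ring)
  have hX : (margSnd ρ * matPow σ ((β - 1) / β)).trace.re = T ^ (1 / β) := by
    have h1 : margSnd ρ * matPow (margSnd ρ) (β * ((β - 1) / β)) = matPow (margSnd ρ) β := by
      nth_rw 1 [← matPow_one_right hBd.1]
      rw [matPow_mul_matPow hBd.1]
      congr 1
      field_simp; ring
    rw [hσpow, mul_smul_comm, h1, trace_smul, smul_eq_mul, Complex.re_ofReal_mul, ← hT,
      supPow, if_neg (inv_ne_zero hB.ne'), Real.inv_rpow hB.le, ← Real.rpow_neg hB.le]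
    nth_rw 2 [← Real.rpow_one T]
    rw [← Real.rpow_add hB]
    congr 1
    field_simp; ring
  rw [sandwich_kronecker_zero hρ.1 hτ.1 hσ.1 hsB, ← matPow_kronecker hτ.1 hσ.1, hX] at key
  have hY := trace_sandwich_re_nonneg hρ.1
    ((hτ.1.kronecker (PosSemidef.one (n := B) (R := ℂ))).matPow ((1 - α) / (2 * α))) α
  have hZ := trace_sandwich_re_nonneg hρ.1
    ((hτ.1.kronecker hσ.1).matPow ((1 - γ) / (2 * γ))) γ
  rw [← hT]
  revert key hY hZ
  generalize (matPow (matPow (τ ⊗ₖ (1 : Matrix B B ℂ)) ((1 - α) / (2 * α)) * ρ *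
    matPow (τ ⊗ₖ (1 : Matrix B B ℂ)) ((1 - α) / (2 * α))) α).trace.re = Y
  generalize (matPow (matPow (τ ⊗ₖ σ) ((1 - γ) / (2 * γ)) * ρ *
    matPow (τ ⊗ₖ σ) ((1 - γ) / (2 * γ))) γ).trace.re = Z
  intro key hY hZ
  have hlog := logb_le_of_le_rpow_mul_rpow (Real.rpow_pos_of_pos hB _) hZ hY
    (by rw [hs]; positivity) (by positivity) key
  rw [Real.logb_rpow_eq_mul_logb_of_pos hB] at hlog
  have hlog' := mul_le_mul_of_nonneg_left hlog hb0.le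
  have e0 : b * (1 / β) = -(1 - β)⁻¹ := by
    rw [← inv_neg, neg_sub, hb]; field_simp
  have e1 : b * ((1 - a / b) / γ) = -(γ - 1)⁻¹ := by
    rw [hs, ← inv_neg, neg_sub]
    calc _ = c / γ := by field_simp
      _ = _ := by rw [hc]; field_simp
  have e2 : b * (a / b / α) = (α - 1)⁻¹ := by
    calc _ = a / α := by field_simp
      _ = _ := by rw [ha]; field_simp
  rw [mul_add, ← mul_assoc, ← mul_assoc, ← mul_assoc, e0, e1, e2] at hlog'
  linarith

lemma EReal.le_coe_sub_comm {x y : EReal} {r : ℝ} : x ≤ (r : EReal) - y ↔ y ≤ (r : EReal) - x := by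
  rw [EReal.le_sub_iff_add_le (by simp) (by simp), EReal.le_sub_iff_add_le (by simp) (by simp),
    add_comm]

end RenyiDecomposition

/-- **Proposition 3:** for `1/α' = 1/β' + 1/γ'`: if `α ∈ (0,1)`, `β ∈ [1/2,1)`, `γ ∈ (1,∞)`
then the decomposition rules hold with `≥`; if `γ ∈ [1/2,1)`, `β ∈ (1,2)`, `α ∈ (1,∞)` they
hold with `≤`. -/
theorem renyi_decomposition_prop3
    {A B : Type*} [Fintype A] [Fintype B] [DecidableEq A] [DecidableEq B]
    (ρ : Matrix (A × B) (A × B) ℂ) (hρ : IsDensity ρ)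
    {α β γ : ℝ} (hα1 : α ≠ 1) (hβ1 : β ≠ 1) (hγ1 : γ ≠ 1)
    (hrel : α / (α - 1) = β / (β - 1) + γ / (γ - 1)) :
    ((0 < α ∧ α < 1) → (1 / 2 ≤ β ∧ β < 1) → (1 < γ) →
      (mutInfUp γ ρ ≥ (renyiEntropy β (margSnd ρ) : EReal) - condEntDown α ρ ∧
        mutInfDown γ ρ ≥ (renyiEntropy β (margSnd ρ) : EReal) - condEntUp α ρ)) ∧
    ((1 / 2 ≤ γ ∧ γ < 1) → (1 < β ∧ β < 2) → (1 < α) →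
      (mutInfUp γ ρ ≤ (renyiEntropy β (margSnd ρ) : EReal) - condEntDown α ρ ∧
        mutInfDown γ ρ ≤ (renyiEntropy β (margSnd ρ) : EReal) - condEntUp α ρ)) := by
  constructor
  · rintro ⟨hα, hα1⟩ ⟨hβ, hβ1⟩ hγ
    have key := fun {τ : Matrix A A ℂ} (hτ : IsDensity τ) {σ : Matrix B B ℂ} (hσ : IsDensity σ) =>
      renyiEntropy_add_renyiDiv_le hρ hτ hσ hrel hα hα1 (by linarith) hβ1 hγ
    constructor
    · refine le_iInf fun σB => ?_
      rw [condEntDown, sub_eq_add_neg, neg_neg]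
      exact key hρ.margFst σB.2
    · refine le_iInf₂ fun σA σB => le_trans ?_ (key σA.2 σB.2)
      have h := le_iSup (fun σA : {σ : Matrix A A ℂ // IsDensity σ} =>
        - renyiDiv α ρ ((σA : Matrix A A ℂ) ⊗ₖ (1 : Matrix B B ℂ))) σA
      have := EReal.sub_le_sub (le_refl (renyiEntropy β (margSnd ρ) : EReal)) h
      rwa [sub_eq_add_neg _ (- renyiDiv _ _ _), neg_neg] at this
  · rintro ⟨hγ, hγ1⟩ ⟨hβ, -⟩ hα
    have key := fun {τ : Matrix A A ℂ} (hτ : IsDensity τ) =>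
      exists_renyiDiv_le_renyiEntropy_add hρ hτ hrel hα hβ (by linarith) hγ1
    constructor
    · obtain ⟨σ, hσ, hle⟩ := key hρ.margFst
      rw [mutInfUp, condEntDown, sub_eq_add_neg, neg_neg]
      exact iInf_le_of_le ⟨σ, hσ⟩ hle
    · have h : condEntUp α ρ ≤ (renyiEntropy β (margSnd ρ) : EReal) - mutInfDown γ ρ := by
        refine iSup_le fun σA => ?_
        obtain ⟨σ, hσ, hle⟩ := key σA.2
        have hinf : mutInfDown γ ρ ≤ (renyiEntropy β (margSnd ρ) : EReal) +
            renyiDiv α ρ ((σA : Matrix A A ℂ) ⊗ₖ (1 : Matrix B B ℂ)) := by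
          rw [mutInfDown]
          exact iInf_le_of_le σA (iInf_le_of_le ⟨σ, hσ⟩ hle)
        rw [EReal.le_coe_sub_comm, sub_eq_add_neg, neg_neg]
        exact hinf
      rwa [EReal.le_coe_sub_comm]
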